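/- arXiv:2511.14316 — 2 statements merged into one kernel-verified Lean document; each statement's English description precedes it below -/
import Mathlib

section
/- (Sylvester's 1851 Theorem.) Let r ≥ 1 and d = 2r−1. There exists a nonzero polynomial F in d+1 variables over ℂ such that for every (a_0, a_1, …, a_d) ∈ ℂ^{d+1} with F(a_0,…,a_d) ≠ 0, the binary form f(x,y) = Σ_{i=0}^{d} C(d,i) a_i x^{d−i} y^i admits a decomposition f = Σ_{k=1}^{r} λ_k (x+β_k y)^d with λ_1, …, λ_r ∈ ℂ∖{0} and pairwise distinct β_1, …, β_r ∈ ℂ; in particular WR(f) = r, and this minimal decomposition is unique up to permutation of the summands among all expressions of f as a sum of r terms μ_ℓ M_ℓ^d with μ_ℓ ∈ ℂ∖{0} and pairwise non-proportional linear forms M_ℓ. -/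
open MvPolynomial

/-- The linear form `x + β y` in `ℂ[x,y]`. -/
noncomputable def linForm (β : ℂ) : MvPolynomial (Fin 2) ℂ := X 0 + C β * X 1

/-- Hankel matrix. -/
def hank {R : Type*} (r : ℕ) (a : ℕ → R) : Matrix (Fin r) (Fin r) R :=
  Matrix.of fun i j => a (i + j)

noncomputable def cvec {R : Type*} [CommRing R] (r : ℕ) (a : ℕ → R) : Fin r → R :=
  (hank r a).adjugate.mulVec (fun i => a (i + r))

noncomputable def ppoly {R : Type*} [CommRing R] (r : ℕ) (a : ℕ → R) : Polynomial R :=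
  Polynomial.C (hank r a).det * Polynomial.X ^ r -
    ∑ j : Fin r, Polynomial.C (cvec r a j) * Polynomial.X ^ (j : ℕ)

noncomputable def fdet {R : Type*} [CommRing R] (r : ℕ) (a : ℕ → R) : R :=
  (hank r a).det * Polynomial.resultant (ppoly r a) (Polynomial.derivative (ppoly r a)) r (r - 1)

lemma hank_map {R S : Type*} [CommRing R] [CommRing S] (φ : R →+* S) (r : ℕ) (a : ℕ → R) :
    φ.mapMatrix (hank r a) = hank r (fun i => φ (a i)) := by
  ext i j; simp [hank]

lemma cvec_map {R S : Type*} [CommRing R] [CommRing S] (φ : R →+* S) (r : ℕ) (a : ℕ → R)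
    (j : Fin r) : φ (cvec r a j) = cvec r (fun i => φ (a i)) j := by
  unfold cvec
  rw [← hank_map φ, ← RingHom.map_adjugate]
  simp [Matrix.mulVec, dotProduct]

lemma ppoly_map {R S : Type*} [CommRing R] [CommRing S] (φ : R →+* S) (r : ℕ) (a : ℕ → R) :
    (ppoly r a).map φ = ppoly r (fun i => φ (a i)) := by
  unfold ppoly
  rw [← hank_map φ, ← RingHom.map_det]
  simp only [Polynomial.map_sub, Polynomial.map_mul, Polynomial.map_sum, Polynomial.map_pow,
    Polynomial.map_X, Polynomial.map_C, cvec_map φ]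

lemma fdet_map {R S : Type*} [CommRing R] [CommRing S] (φ : R →+* S) (r : ℕ) (a : ℕ → R) :
    φ (fdet r a) = fdet r (fun i => φ (a i)) := by
  unfold fdet
  rw [map_mul, ← Polynomial.resultant_map_map, ← Polynomial.derivative_map, ppoly_map, RingHom.map_det, hank_map]

lemma cvec_rec {R : Type*} [CommRing R] (r : ℕ) (a : ℕ → R) (i : Fin r) :
    ∑ j : Fin r, a (i + j) * cvec r a j = (hank r a).det * a (i + r) := by
  have h : (hank r a).mulVec (cvec r a) = (hank r a).det • (fun i : Fin r => a (i + r)) := by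
    unfold cvec
    rw [Matrix.mulVec_mulVec, Matrix.mul_adjugate, Matrix.smul_mulVec, Matrix.one_mulVec]
  have := congrFun h i
  simpa [Matrix.mulVec, dotProduct, hank] using this

lemma ppoly_natDegree (r : ℕ) (a : ℕ → ℂ) (h : (hank r a).det ≠ 0) :
    (ppoly r a).natDegree = r := by
  unfold ppoly
  have h1 : (Polynomial.C (hank r a).det * Polynomial.X ^ r).degree = (r : WithBot ℕ) :=
    Polynomial.degree_C_mul_X_pow r h
  have h2 : (∑ j : Fin r, Polynomial.C (cvec r a j) * Polynomial.X ^ (j : ℕ)).degree < (r : WithBot ℕ) := by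
    exact Polynomial.degree_sum_fin_lt _
  apply Polynomial.natDegree_eq_of_degree_eq_some
  rw [Polynomial.degree_sub_eq_left_of_degree_lt (by rw [h1]; exact h2), h1]

lemma ppoly_ne_zero (r : ℕ) (hr : 1 ≤ r) (a : ℕ → ℂ) (h : (hank r a).det ≠ 0) : ppoly r a ≠ 0 := by
  intro h0
  have := ppoly_natDegree r a h
  rw [h0] at this
  simp at this; omega

lemma ppoly_eval (r : ℕ) (a : ℕ → ℂ) (t : ℂ) : (ppoly r a).eval t =
    (hank r a).det * t ^ r - ∑ j : Fin r, cvec r a j * t ^ (j : ℕ) := by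
  simp [ppoly, Polynomial.eval_finsetSum]

lemma fdet_ne_iff (r : ℕ) (hr : 1 ≤ r) (a : ℕ → ℂ) :
    fdet r a ≠ 0 ↔ (hank r a).det ≠ 0 ∧ (ppoly r a).Separable := by
  unfold fdet
  rw [mul_ne_zero_iff, and_congr_right_iff]
  intro h
  have hd := ppoly_natDegree r a h
  have hd' : (Polynomial.derivative (ppoly r a)).natDegree = r - 1 := by
    rw [Polynomial.natDegree_derivative, hd]
  have := @Polynomial.resultant_eq_zero_iff ℂ _ (ppoly r a) (Polynomial.derivative (ppoly r a))
  rw [hd, hd'] at this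
  rw [Ne, this, Polynomial.separable_def]
  simp [ppoly_ne_zero r hr a h]

/-- Points of a decomposition are roots. -/
lemma root_of_decomp (r : ℕ) (a : ℕ → ℂ) (lam β : Fin r → ℂ) (hl : ∀ k, lam k ≠ 0)
    (hβ : Function.Injective β) (ha : ∀ i < 2 * r, a i = ∑ k, lam k * β k ^ i) (k : Fin r) :
    (ppoly r a).eval (β k) = 0 := by
  have key : (fun k => lam k * (ppoly r a).eval (β k)) = 0 := by
    apply Matrix.eq_zero_of_forall_pow_sum_mul_pow_eq_zero hβ
    intro i
    have h := cvec_rec r a i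
    rw [ha (i + r) (by omega)] at h
    have h2 : ∀ j : Fin r, a (i + j) = ∑ k, lam k * β k ^ ((i : ℕ) + j) := fun j => ha _ (by omega)
    simp_rw [h2, Finset.sum_mul] at h
    rw [Finset.sum_comm, Finset.mul_sum, ← sub_eq_zero, ← Finset.sum_sub_distrib] at h
    rw [← neg_eq_zero, ← Finset.sum_neg_distrib, ← h]
    refine Finset.sum_congr rfl fun k _ => ?_
    rw [ppoly_eval, mul_sub, sub_mul, Finset.mul_sum, Finset.sum_mul, neg_sub]
    congr 1
    · refine Finset.sum_congr rfl fun j _ => ?_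
      ring
    · ring
  have := congrFun key k
  simpa [hl k] using this

lemma det_of_decomp (r : ℕ) (a : ℕ → ℂ) (β : Fin r → ℂ) (hβ : Function.Injective β)
    (ha : ∀ i < 2 * r, a i = ∑ k, β k ^ i) : (hank r a).det ≠ 0 := by
  have : hank r a = (Matrix.vandermonde β).transpose * Matrix.vandermonde β := by
    ext i j
    rw [Matrix.vandermonde_transpose_mul_vandermonde, hank, Matrix.of_apply, ha _ (by omega)]
  rw [this, Matrix.det_mul, Matrix.det_transpose]
  have := Matrix.det_vandermonde_ne_zero_iff.mpr hβ
  exact mul_ne_zero this this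

lemma roots_eq (r : ℕ) (hr : 1 ≤ r) (a : ℕ → ℂ) (β : Fin r → ℂ) (hβ : Function.Injective β)
    (h : (hank r a).det ≠ 0) (hroot : ∀ k, (ppoly r a).eval (β k) = 0) :
    (Finset.univ.image β).val = (ppoly r a).roots := by
  apply Multiset.eq_of_le_of_card_le
  · rw [Finset.val_le_iff_val_subset]
    intro x hx
    simp only [Finset.mem_val, Finset.mem_image, Finset.mem_univ, true_and] at hx
    obtain ⟨k, rfl⟩ := hx
    rw [Polynomial.mem_roots (ppoly_ne_zero r hr a h)]
    exact hroot k
  · have := Polynomial.card_roots' (ppoly r a)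
    rw [ppoly_natDegree r a h] at this
    rw [Finset.card_val, Finset.card_image_of_injective _ hβ]
    simpa using this

lemma fdet_special (r : ℕ) (hr : 1 ≤ r) (a : ℕ → ℂ)
    (ha : ∀ i < 2 * r, a i = ∑ k : Fin r, ((k : ℕ) : ℂ) ^ i) : fdet r a ≠ 0 := by
  have hβ : Function.Injective (fun k : Fin r => ((k : ℕ) : ℂ)) := by
    intro i j h; simpa [Fin.ext_iff] using h
  have hd := det_of_decomp r a _ hβ ha
  rw [fdet_ne_iff r hr]
  refine ⟨hd, ?_⟩
  have hroot := root_of_decomp r a (fun _ => 1) _ (by simp) hβ (by simpa using ha)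
  have := roots_eq r hr a _ hβ hd hroot
  rw [← Polynomial.nodup_roots_iff_of_splits (ppoly_ne_zero r hr a hd) (IsAlgClosed.splits _), ← this]
  exact Finset.nodup _

lemma exists_beta (r : ℕ) (hr : 1 ≤ r) (a : ℕ → ℂ) (h : fdet r a ≠ 0) :
    ∃ β : Fin r → ℂ, Function.Injective β ∧ ∀ k, (ppoly r a).eval (β k) = 0 := by
  obtain ⟨hd, hs⟩ := (fdet_ne_iff r hr a).mp h
  have hc : (ppoly r a).roots.toFinset.card = r := by
    rw [Multiset.toFinset_card_of_nodup (Polynomial.nodup_roots hs),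
      ← (IsAlgClosed.splits (ppoly r a)).natDegree_eq_card_roots, ppoly_natDegree r a hd]
  let e := (Finset.equivFinOfCardEq hc).symm
  refine ⟨fun k => (e k : ℂ), fun i j hij => e.injective (Subtype.ext hij), fun k => ?_⟩
  have := (e k).2
  rw [Multiset.mem_toFinset, Polynomial.mem_roots (ppoly_ne_zero r hr a hd)] at this
  exact this

lemma exists_decomp (r : ℕ) (hr : 1 ≤ r) (a : ℕ → ℂ) (h : fdet r a ≠ 0) :
    ∃ lam β : Fin r → ℂ, Function.Injective β ∧ ∀ i < 2 * r, a i = ∑ k, lam k * β k ^ i := by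
  obtain ⟨β, hβ, hroot⟩ := exists_beta r hr a h
  obtain ⟨hd, hs⟩ := (fdet_ne_iff r hr a).mp h
  have hV : IsUnit (Matrix.vandermonde β).transpose := by
    rw [Matrix.isUnit_iff_isUnit_det, Matrix.det_transpose]
    exact (Matrix.det_vandermonde_ne_zero_iff.mpr hβ).isUnit
  obtain ⟨lam, hlam⟩ := (Matrix.mulVec_surjective_iff_isUnit.mpr hV) (fun i : Fin r => a i)
  refine ⟨lam, β, hβ, ?_⟩
  have h0 : ∀ i < r, a i = ∑ k, lam k * β k ^ i := by
    intro i hi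
    have := congrFun hlam ⟨i, hi⟩
    simp only [Matrix.mulVec, dotProduct, Matrix.transpose_apply, Matrix.vandermonde_apply] at this
    rw [← this]
    exact Finset.sum_congr rfl fun _ _ => mul_comm _ _
  intro i
  induction i using Nat.strong_induction_on with
  | _ i ih =>
    intro hi
    rcases lt_or_ge i r with hir | hir
    · exact h0 i hir
    · obtain ⟨m, rfl⟩ := Nat.exists_eq_add_of_le' hir
      have hm : m < r := by omega
      apply mul_left_cancel₀ hd
      have h1 := cvec_rec r a ⟨m, hm⟩
      simp only at h1
      rw [← h1, Finset.mul_sum]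
      have h2 : ∀ j : Fin r, a (m + j) = ∑ k, lam k * β k ^ (m + (j : ℕ)) :=
        fun j => ih _ (by omega) (by omega)
      simp_rw [h2, Finset.sum_mul]
      rw [Finset.sum_comm]
      refine Finset.sum_congr rfl fun k _ => ?_
      have h3 := hroot k
      rw [ppoly_eval, sub_eq_zero] at h3
      rw [pow_add, show (hank r a).det * (lam k * (β k ^ m * β k ^ r)) =
        lam k * β k ^ m * ((hank r a).det * β k ^ r) by ring, h3, Finset.mul_sum]
      refine Finset.sum_congr rfl fun j _ => ?_
      ring

lemma hank_factor (r s : ℕ) (a : ℕ → ℂ) (μ u v : Fin s → ℂ)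
    (ha : ∀ i < 2 * r, a i = ∑ l, μ l * (u l ^ (2 * r - 1 - i) * v l ^ i)) :
    hank r a = (Matrix.of fun (i : Fin r) (l : Fin s) => μ l * (u l ^ (r - 1 - (i : ℕ)) * v l ^ (i : ℕ))) *
      (Matrix.of fun (l : Fin s) (j : Fin r) => u l ^ (r - (j : ℕ)) * v l ^ (j : ℕ)) := by
  ext i j
  rw [Matrix.mul_apply, hank, Matrix.of_apply, ha _ (by omega)]
  refine Finset.sum_congr rfl fun l _ => ?_
  simp only [Matrix.of_apply]
  rw [show 2 * r - 1 - ((i : ℕ) + j) = (r - 1 - i) + (r - j) by omega, pow_add, pow_add]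
  ring

lemma le_of_factor (r s : ℕ) (a : ℕ → ℂ) (μ u v : Fin s → ℂ) (hd : (hank r a).det ≠ 0)
    (ha : ∀ i < 2 * r, a i = ∑ l, μ l * (u l ^ (2 * r - 1 - i) * v l ^ i)) : r ≤ s := by
  have h := hank_factor r s a μ u v ha
  have h1 : (hank r a).rank = r := by
    rw [Matrix.rank_of_isUnit _ ((Matrix.isUnit_iff_isUnit_det _).mpr hd.isUnit)]
    simp
  rw [← h1, h]
  refine (Matrix.rank_mul_le_left _ _).trans ((Matrix.rank_le_card_width _).trans ?_)
  simp

lemma ne_of_factor (r : ℕ) (a : ℕ → ℂ) (μ u v : Fin r → ℂ) (hd : (hank r a).det ≠ 0)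
    (ha : ∀ i < 2 * r, a i = ∑ l, μ l * (u l ^ (2 * r - 1 - i) * v l ^ i)) (l : Fin r) :
    μ l ≠ 0 ∧ u l ≠ 0 := by
  rw [hank_factor r r a μ u v ha, Matrix.det_mul, mul_ne_zero_iff] at hd
  constructor
  · intro h0
    apply hd.1
    apply Matrix.det_eq_zero_of_column_eq_zero l
    intro i; simp [h0]
  · intro h0
    apply hd.2
    apply Matrix.det_eq_zero_of_row_eq_zero l
    intro j
    have : r - (j : ℕ) ≠ 0 := by omega
    simp [h0, this]

lemma inj_of_factor (r : ℕ) (a : ℕ → ℂ) (lam β : Fin r → ℂ) (hd : (hank r a).det ≠ 0)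
    (ha : ∀ i < 2 * r, a i = ∑ l, lam l * β l ^ i) : Function.Injective β := by
  rw [hank_factor r r a lam (fun _ => 1) β (by simpa using ha), Matrix.det_mul, mul_ne_zero_iff] at hd
  rw [← Matrix.det_vandermonde_ne_zero_iff]
  convert hd.2 using 2
  ext i j
  simp [Matrix.vandermonde_apply]

lemma unique_decomp (r : ℕ) (hr : 1 ≤ r) (a : ℕ → ℂ) (hd : (hank r a).det ≠ 0)
    (lam β lam' β' : Fin r → ℂ) (hl : ∀ k, lam k ≠ 0) (hl' : ∀ k, lam' k ≠ 0)
    (ha : ∀ i < 2 * r, a i = ∑ l, lam l * β l ^ i)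
    (ha' : ∀ i < 2 * r, a i = ∑ l, lam' l * β' l ^ i) :
    ∃ σ : Equiv.Perm (Fin r), ∀ l, lam' l = lam (σ l) ∧ β' l = β (σ l) := by
  have hβ := inj_of_factor r a lam β hd ha
  have hβ' := inj_of_factor r a lam' β' hd ha'
  have e := roots_eq r hr a β hβ hd (root_of_decomp r a lam β hl hβ ha)
  have e' := roots_eq r hr a β' hβ' hd (root_of_decomp r a lam' β' hl' hβ' ha')
  have e2 : Finset.univ.image β' = Finset.univ.image β := Finset.val_injective (e'.trans e.symm)
  have hex : ∀ l, ∃ k, β k = β' l := by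
    intro l
    have : β' l ∈ Finset.univ.image β := by rw [← e2]; simp
    simpa using this
  choose σ hσ using hex
  have hinj : Function.Injective σ := by
    intro i j hij
    apply hβ'
    rw [← hσ, ← hσ, hij]
  let s : Equiv.Perm (Fin r) := Equiv.ofBijective σ (Finite.injective_iff_bijective.mp hinj)
  refine ⟨s, fun l => ⟨?_, (hσ l).symm⟩⟩
  have key : (fun l => lam' l - lam (s l)) = 0 := by
    apply Matrix.eq_zero_of_forall_pow_sum_mul_pow_eq_zero hβ'
    intro i
    simp_rw [sub_mul]
    rw [Finset.sum_sub_distrib, ← ha' i (by omega), sub_eq_zero, ha i (by omega),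
      ← Equiv.sum_comp s]
    refine Finset.sum_congr rfl fun k _ => ?_
    rw [← hσ k]; rfl
  have := congrFun key l
  simpa [sub_eq_zero] using this

noncomputable def bform (d : ℕ) (a : ℕ → ℂ) : MvPolynomial (Fin 2) ℂ :=
  ∑ i ∈ Finset.range (d + 1), C ((d.choose i : ℂ) * a i) * X 0 ^ (d - i) * X 1 ^ i

lemma bform_inj (d : ℕ) (a b : ℕ → ℂ) (h : bform d a = bform d b) (i : ℕ) (hi : i < d + 1) :
    a i = b i := by
  have h1 := congrArg (fun p => (aeval (![1, Polynomial.X] : Fin 2 → Polynomial ℂ) p).coeff i) h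
  have h2 : ∀ c : ℕ → ℂ, (aeval (![1, Polynomial.X] : Fin 2 → Polynomial ℂ) (bform d c)).coeff i
      = (d.choose i : ℂ) * c i := by
    intro c
    simp only [bform, map_sum, map_mul, map_pow, aeval_X, algHom_C]
    simp only [Matrix.cons_val_zero, Matrix.cons_val_one, one_pow, mul_one,
      Polynomial.finsetSum_coeff]
    rw [Finset.sum_eq_single i]
    · rw [← map_mul, Polynomial.algebraMap_eq, Polynomial.coeff_C_mul_X_pow, if_pos rfl]
    · intro j _ hj
      rw [← map_mul, Polynomial.algebraMap_eq, Polynomial.coeff_C_mul_X_pow, if_neg (Ne.symm hj)]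
    · intro hh; simp at hh; omega
  simp only [h2] at h1
  refine mul_left_cancel₀ ?_ h1
  exact_mod_cast (Nat.choose_pos (by omega)).ne'

lemma pow_sum_eq (d s : ℕ) (μ u v : Fin s → ℂ) :
    ∑ l, C (μ l) * (C (u l) * X 0 + C (v l) * X 1 : MvPolynomial (Fin 2) ℂ) ^ d =
      bform d (fun i => ∑ l, μ l * (u l ^ (d - i) * v l ^ i)) := by
  unfold bform
  simp_rw [Finset.mul_sum, map_sum, Finset.sum_mul]
  rw [Finset.sum_comm]
  refine Finset.sum_congr rfl fun l _ => ?_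
  rw [add_comm (C (u l) * X 0), add_pow, Finset.mul_sum]
  refine Finset.sum_congr rfl fun i _ => ?_
  simp only [mul_pow, map_mul, map_pow, map_natCast]
  ring

lemma lin_of_hom (M : MvPolynomial (Fin 2) ℂ) (h : M.IsHomogeneous 1) :
    ∃ u v : ℂ, M = C u * X 0 + C v * X 1 := by
  refine ⟨coeff (Finsupp.single 0 1) M, coeff (Finsupp.single 1 1) M, ?_⟩
  ext m
  by_cases hm : m.degree = 1
  · obtain ⟨i, rfl⟩ : ∃ i, m = Finsupp.single i 1 := by
      have h2 : m 0 + m 1 = 1 := by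
        rw [Finsupp.degree_eq_sum] at hm
        simpa using hm
      rcases Nat.eq_zero_or_pos (m 0) with h0 | h0
      · refine ⟨1, ?_⟩
        ext i; fin_cases i
        · simpa using h0
        · simp; omega
      · refine ⟨0, ?_⟩
        ext i; fin_cases i
        · simp; omega
        · simp; omega
    fin_cases i <;> simp [coeff_C_mul, coeff_X, Finsupp.single_left_inj]
  · rw [h.coeff_eq_zero hm]
    have h1 : ((C (coeff (Finsupp.single 0 1) M) * X 0 + C (coeff (Finsupp.single 1 1) M) * X 1 : MvPolynomial (Fin 2) ℂ)).IsHomogeneous 1 :=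
      (isHomogeneous_C_mul_X _ _).add (isHomogeneous_C_mul_X _ _)
    rw [h1.coeff_eq_zero hm]

/-- (Sylvester's 1851 Theorem.) Let `r ≥ 1` and `d = 2r−1`. There is a nonzero polynomial `F`
in `d+1` variables such that whenever `F(a_0,…,a_d) ≠ 0`, the binary form
`f = Σ_{i=0}^{d} C(d,i) a_i x^{d−i} y^i` admits a decomposition
`f = Σ_{k=1}^{r} λ_k (x+β_k y)^d` with all `λ_k ≠ 0` and pairwise distinct `β_k`; in
particular `WR(f) = r` (i.e. `r` is the least length of a decomposition into powers of linear
forms with nonzero coefficients), and this minimal decomposition is unique up to a permutation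
of the summands among all expressions of `f` as a sum of `r` terms `μ_ℓ M_ℓ^d` with `μ_ℓ ≠ 0`
and pairwise non-proportional linear forms `M_ℓ`. -/
theorem sylvester_1851 (r : ℕ) (hr : 1 ≤ r) :
    ∃ F : MvPolynomial (Fin (2 * r)) ℂ, F ≠ 0 ∧
      ∀ a : Fin (2 * r) → ℂ, eval a F ≠ 0 →
        ∀ f : MvPolynomial (Fin 2) ℂ,
          f = (∑ i : Fin (2 * r),
              C (((2 * r - 1).choose i : ℂ) * a i) * X 0 ^ (2 * r - 1 - (i : ℕ)) *
                X 1 ^ (i : ℕ)) →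
          ∃ lam β : Fin r → ℂ, (∀ k, lam k ≠ 0) ∧ Function.Injective β ∧
            f = (∑ k, C (lam k) * (linForm (β k)) ^ (2 * r - 1)) ∧
            IsLeast {s : ℕ | ∃ (μ : Fin s → ℂ) (L : Fin s → MvPolynomial (Fin 2) ℂ),
                (∀ ℓ, μ ℓ ≠ 0) ∧ (∀ ℓ, (L ℓ).IsHomogeneous 1) ∧
                f = ∑ ℓ, C (μ ℓ) * (L ℓ) ^ (2 * r - 1)} r ∧
            ∀ (μ : Fin r → ℂ) (M : Fin r → MvPolynomial (Fin 2) ℂ),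
              (∀ ℓ, μ ℓ ≠ 0) → (∀ ℓ, (M ℓ).IsHomogeneous 1) →
              (∀ ℓ ℓ', ℓ ≠ ℓ' → ∀ t : ℂ, M ℓ ≠ C t * M ℓ') →
              f = ∑ ℓ, C (μ ℓ) * (M ℓ) ^ (2 * r - 1) →
              ∃ σ : Equiv.Perm (Fin r), ∀ ℓ,
                C (μ ℓ) * (M ℓ) ^ (2 * r - 1)
                  = C (lam (σ ℓ)) * (linForm (β (σ ℓ))) ^ (2 * r - 1) := by
  have hev : ∀ a : Fin (2 * r) → ℂ,
      eval a (fdet r (fun i => if h : i < 2 * r then (X ⟨i, h⟩ : MvPolynomial (Fin (2 * r)) ℂ) else 0))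
        = fdet r (fun i => if h : i < 2 * r then a ⟨i, h⟩ else 0) := by
    intro a
    rw [fdet_map]
    congr 1
    funext i
    split_ifs <;> simp
  refine ⟨fdet r (fun i => if h : i < 2 * r then X ⟨i, h⟩ else 0), ?_, ?_⟩
  · intro h0
    have h1 := hev (fun i => ∑ k : Fin r, ((k : ℕ) : ℂ) ^ (i : ℕ))
    rw [h0, map_zero] at h1
    exact fdet_special r hr _ (fun i hi => by simp [hi]) h1.symm
  · intro a' hF f hf
    rw [hev] at hF
    set a : ℕ → ℂ := fun i => if h : i < 2 * r then a' ⟨i, h⟩ else 0 with ha_def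
    have hd2 : 2 * r - 1 + 1 = 2 * r := by omega
    have hfb : f = bform (2 * r - 1) a := by
      rw [hf, bform, hd2, ← Fin.sum_univ_eq_sum_range
        (fun i => C (((2 * r - 1).choose i : ℂ) * a i) * X 0 ^ (2 * r - 1 - i) * X 1 ^ i)]
      refine Finset.sum_congr rfl fun i _ => ?_
      simp [ha_def]
    have hd := ((fdet_ne_iff r hr a).mp hF).1
    have hcoef : ∀ (s : ℕ) (μ u v : Fin s → ℂ),
        f = ∑ l, C (μ l) * (C (u l) * X 0 + C (v l) * X 1 : MvPolynomial (Fin 2) ℂ) ^ (2 * r - 1) →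
        ∀ i < 2 * r, a i = ∑ l, μ l * (u l ^ (2 * r - 1 - i) * v l ^ i) := by
      intro s μ u v h i hi
      rw [pow_sum_eq, hfb] at h
      exact bform_inj _ _ _ h i (by omega)
    obtain ⟨lam, β, hβ, ha⟩ := exists_decomp r hr a hF
    have hl : ∀ k, lam k ≠ 0 := fun k =>
      (ne_of_factor r a lam (fun _ => 1) β hd (by simpa using ha) k).1
    have hlin : ∀ t, linForm t = C 1 * X 0 + C t * X 1 := by intro t; simp [linForm]
    have hfd : f = ∑ k, C (lam k) * (linForm (β k)) ^ (2 * r - 1) := by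
      simp_rw [hlin]
      rw [pow_sum_eq (2 * r - 1) r lam (fun _ => 1) β, hfb]
      unfold bform
      refine Finset.sum_congr rfl fun i hi => ?_
      rw [ha i (by have := Finset.mem_range.mp hi; omega)]
      simp only [one_pow, one_mul]
    refine ⟨lam, β, hl, hβ, hfd, ⟨⟨lam, fun k => linForm (β k), hl, fun k => ?_, hfd⟩, ?_⟩, ?_⟩
    · show (linForm (β k)).IsHomogeneous 1
      rw [hlin]
      exact (isHomogeneous_C_mul_X _ _).add (isHomogeneous_C_mul_X _ _)
    · rintro s ⟨μ, L, -, hL, hs⟩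
      choose u v huv using fun l => lin_of_hom (L l) (hL l)
      simp_rw [huv] at hs
      exact le_of_factor r s a μ u v hd (hcoef s μ u v hs)
    · intro μ M hμ hM _ hs
      choose u v huv using fun l => lin_of_hom (M l) (hM l)
      simp_rw [huv] at hs
      have hc := hcoef r μ u v hs
      have hu := fun l => (ne_of_factor r a μ u v hd hc l).2
      obtain ⟨σ, hσ⟩ := unique_decomp r hr a hd lam β (fun l => μ l * u l ^ (2 * r - 1))
        (fun l => v l / u l) hl (fun l => mul_ne_zero (hμ l) (pow_ne_zero _ (hu l))) ha (by
          intro i hi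
          rw [hc i hi]
          refine Finset.sum_congr rfl fun l _ => ?_
          have := hu l
          rw [show 2 * r - 1 = (2 * r - 1 - i) + i by omega, pow_add, Nat.add_sub_cancel, div_pow]
          field_simp)
      refine ⟨σ, fun l => ?_⟩
      rw [← (hσ l).1, ← (hσ l).2, huv, hlin, map_mul, map_pow, mul_assoc, ← mul_pow, mul_add,
        ← mul_assoc, ← mul_assoc, ← map_mul, ← map_mul, mul_one, mul_div_cancel₀ _ (hu l)]
end

section
/- (Gundelfinger's Theorem, even-degree case.) Let r ≥ 2 and d = 2r−2. There exists a nonzero polynomial F in d+1 variables over ℂ such that for every (a_0, a_1, …, a_d) ∈ ℂ^{d+1} with F(a_0,…,a_d) ≠ 0, the binary form f(x,y) = Σ_{i=0}^{d} C(d,i) a_i x^{d−i} y^i admits a decomposition f = Σ_{k=1}^{r} λ_k (x+β_k y)^d with λ_1, …, λ_r ∈ ℂ∖{0} and pairwise distinct β_1, …, β_r ∈ ℂ, its Waring rank is WR(f) = r, and moreover f admits infinitely many such decompositions, i.e. there are infinitely many distinct sets {β_1,…,β_r} ⊂ ℂ occurring in decompositions of this form. -/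
open MvPolynomial

/-- Polynomial form of nondegeneracy, injectivity. -/
lemma hank_inj (r : ℕ) (Λ : Polynomial ℂ →ₗ[ℂ] ℂ)
    (hdet : (Matrix.of fun i j : Fin r => Λ (Polynomial.X ^ ((i : ℕ) + j))).det ≠ 0)
    (h : Polynomial ℂ) (hd : h.degree < r)
    (h0 : ∀ i : ℕ, i < r → Λ (h * Polynomial.X ^ i) = 0) : h = 0 := by
  have hh := h.as_sum_range' r
  by_cases hz : h = 0
  · exact hz
  have hnd : h.natDegree < r := (Polynomial.natDegree_lt_iff_degree_lt hz).2 hd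
  have key : (Matrix.of fun i j : Fin r => Λ (Polynomial.X ^ ((i : ℕ) + j))).mulVec
      (fun j => h.coeff j) = 0 := by
    ext i
    have := h0 i i.2
    rw [h.as_sum_range' r hnd, Finset.sum_mul, map_sum, Finset.sum_range] at this
    simp only [Matrix.mulVec, dotProduct, Matrix.of_apply, Pi.zero_apply]
    rw [← this]
    refine Finset.sum_congr rfl fun j _ => ?_
    rw [← Polynomial.C_mul_X_pow_eq_monomial, mul_assoc, ← pow_add, ← Polynomial.smul_eq_C_mul,
      map_smul, smul_eq_mul, mul_comm, add_comm]
  have := Matrix.eq_zero_of_mulVec_eq_zero hdet key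
  ext n
  by_cases hn : n < r
  · simpa using congrFun this ⟨n, hn⟩
  · rw [Polynomial.coeff_eq_zero_of_natDegree_lt (by omega)]; simp

/-- Polynomial form of nondegeneracy, surjectivity. -/
lemma hank_surj (r : ℕ) (Λ : Polynomial ℂ →ₗ[ℂ] ℂ)
    (hdet : (Matrix.of fun i j : Fin r => Λ (Polynomial.X ^ ((i : ℕ) + j))).det ≠ 0)
    (v : ℕ → ℂ) : ∃ h : Polynomial ℂ, h.degree < r ∧
      ∀ i : ℕ, i < r → Λ (h * Polynomial.X ^ i) = v i := by
  set H := (Matrix.of fun i j : Fin r => Λ (Polynomial.X ^ ((i : ℕ) + j))) with hH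
  set c := H⁻¹.mulVec (fun i => v i) with hc
  have hHc : H.mulVec c = fun i : Fin r => v i := by
    rw [hc, Matrix.mulVec_mulVec, Matrix.mul_nonsing_inv _ (isUnit_iff_ne_zero.2 hdet),
      Matrix.one_mulVec]
  refine ⟨∑ j : Fin r, Polynomial.C (c j) * Polynomial.X ^ (j : ℕ), ?_, ?_⟩
  · refine (Polynomial.degree_sum_le _ _).trans_lt ?_
    refine (Finset.sup_lt_iff (WithBot.bot_lt_coe r)).2 ?_
    intro j _
    exact (Polynomial.degree_C_mul_X_pow_le _ _).trans_lt (WithBot.coe_lt_coe.2 j.2)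
  · intro i hi
    have := congrFun hHc ⟨i, hi⟩
    simp only at this
    rw [← this, Finset.sum_mul, map_sum]
    simp only [Matrix.mulVec, dotProduct, hH, Matrix.of_apply]
    refine Finset.sum_congr rfl fun j _ => ?_
    rw [mul_assoc, ← pow_add, ← Polynomial.smul_eq_C_mul,
      map_smul, smul_eq_mul, mul_comm, add_comm]

/-- Vanishing against monomials gives vanishing against polynomials of small degree. -/
lemma lam_low (n : ℕ) (Λ : Polynomial ℂ →ₗ[ℂ] ℂ) (q : Polynomial ℂ)
    (h0 : ∀ i : ℕ, i < n → Λ (q * Polynomial.X ^ i) = 0) (s : Polynomial ℂ)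
    (hs : s.degree < n) : Λ (q * s) = 0 := by
  by_cases hz : s = 0
  · simp [hz]
  have hnd : s.natDegree < n := (Polynomial.natDegree_lt_iff_degree_lt hz).2 hs
  rw [s.as_sum_range' n hnd, Finset.mul_sum, map_sum]
  refine Finset.sum_eq_zero fun j hj => ?_
  rw [← Polynomial.C_mul_X_pow_eq_monomial, mul_left_comm, ← Polynomial.smul_eq_C_mul,
      map_smul, h0 j (Finset.mem_range.1 hj), smul_zero]

/-- A squarefree annihilating polynomial gives a decomposition. -/
lemma quad_rule (n : ℕ) (Λ : Polynomial ℂ →ₗ[ℂ] ℂ)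
    (hdet : (Matrix.of fun i j : Fin (n+1) => Λ (Polynomial.X ^ ((i : ℕ) + j))).det ≠ 0)
    (q : Polynomial ℂ) (hq : q.Monic) (hqd : q.natDegree = n + 1)
    (h0 : ∀ i : ℕ, i < n → Λ (q * Polynomial.X ^ i) = 0)
    (B : Finset ℂ) (hB : B.card = n + 1) (hr : ∀ b ∈ B, q.eval b = 0) :
    ∃ lam : ℂ → ℂ, (∀ b ∈ B, lam b ≠ 0) ∧
      ∀ i : ℕ, i < 2 * n + 1 → Λ (Polynomial.X ^ i) = ∑ b ∈ B, lam b * b ^ i := by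
  have hinj : Set.InjOn (id : ℂ → ℂ) B := fun _ _ _ _ h => h
  have main : ∀ h : Polynomial ℂ, h.degree < (2 * n + 1 : ℕ) →
      Λ h = ∑ b ∈ B, Λ (Lagrange.basis B id b) * h.eval b := by
    intro h hh
    have e1 := Polynomial.modByMonic_add_div h q
    have hm : (h %ₘ q).degree < B.card := by
      have := Polynomial.degree_modByMonic_lt h hq
      rwa [Polynomial.degree_eq_natDegree hq.ne_zero, hqd, ← hB] at this
    have hs : (h /ₘ q).degree < n := by
      by_cases hlt : h.degree < q.degree
      · rw [(Polynomial.divByMonic_eq_zero_iff hq).2 hlt]; simp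
      · have := Polynomial.degree_add_divByMonic hq (not_lt.1 hlt)
        by_cases hz : h /ₘ q = 0
        · rw [hz]; simp
        by_cases hz' : h = 0
        · simp [hz'] at hz
        rw [Polynomial.degree_eq_natDegree hz, Polynomial.degree_eq_natDegree hz', 
          Polynomial.degree_eq_natDegree hq.ne_zero, hqd] at this
        rw [Polynomial.degree_eq_natDegree hz'] at hh
        rw [Polynomial.degree_eq_natDegree hz]
        norm_cast at *
        omega
    have e2 := Lagrange.eq_interpolate hinj hm
    have hev : ∀ b ∈ B, (h %ₘ q).eval b = h.eval b := by
      intro b hb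
      conv_rhs => rw [← e1]
      simp [hr b hb]
    have e3 : Λ h = Λ (h %ₘ q) := by
      conv_lhs => rw [← e1]
      rw [map_add, lam_low n Λ q h0 _ hs, add_zero]
    rw [e3, e2, Lagrange.interpolate_apply, map_sum]
    refine Finset.sum_congr rfl fun b hb => ?_
    rw [← Polynomial.smul_eq_C_mul, map_smul, smul_eq_mul, mul_comm]
    congr 1
    exact hev b hb
  refine ⟨fun b => Λ (Lagrange.basis B id b), ?_, ?_⟩
  · intro b hb hz
    have hne := Lagrange.basis_ne_zero hinj hb
    have hdeg := Lagrange.degree_basis hinj hb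
    rw [hB] at hdeg
    simp only [Nat.add_sub_cancel] at hdeg
    apply hne
    refine hank_inj (n+1) Λ hdet _ ?_ ?_
    · rw [hdeg]; exact_mod_cast Nat.lt_succ_self n
    · intro i hi
      rw [main]
      · refine Finset.sum_eq_zero fun c hc => ?_
        by_cases hcb : c = b
        · subst hcb; simp only at hz; rw [hz, zero_mul]
        · rw [Polynomial.eval_mul]
          have := Lagrange.eval_basis_of_ne (v := (id : ℂ → ℂ)) (s := B) (Ne.symm hcb) hc
          simp only [id] at this
          rw [show (id : ℂ → ℂ) = fun x => x from rfl] at *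
          rw [this]; simp
      · rw [Polynomial.degree_mul, hdeg, Polynomial.degree_X_pow]
        norm_cast; omega
  · intro i hi
    rw [main _ (by rw [Polynomial.degree_X_pow]; exact_mod_cast hi)]
    simp

/-- The pencil: infinitely many squarefree members. -/
lemma pencil (n : ℕ) (Λ : Polynomial ℂ →ₗ[ℂ] ℂ)
    (hdet : (Matrix.of fun i j : Fin (n+1) => Λ (Polynomial.X ^ ((i : ℕ) + j))).det ≠ 0) :
    {B : Finset ℂ | B.card = n + 1 ∧ ∃ q : Polynomial ℂ, q.Monic ∧ q.natDegree = n + 1 ∧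
      (∀ i : ℕ, i < n → Λ (q * Polynomial.X ^ i) = 0) ∧ ∀ b ∈ B, q.eval b = 0}.Infinite := by
  obtain ⟨g, hgd, hg⟩ := hank_surj (n+1) Λ hdet (fun i => if i = n then 1 else 0)
  obtain ⟨p0, hp0d, hp0⟩ := hank_surj (n+1) Λ hdet (fun i => Λ (Polynomial.X ^ (n + 1 + i)))
  set p := Polynomial.X ^ (n+1) - p0 with hp
  have hgn : Λ (g * Polynomial.X ^ n) = 1 := by simpa using hg n (by omega)
  have hg0 : g ≠ 0 := by rintro rfl; simp at hgn
  have hgl : ∀ i < n, Λ (g * Polynomial.X ^ i) = 0 := by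
    intro i hi
    rw [hg i (by omega)]; simp [hi.ne]
  have hpl : ∀ i < n + 1, Λ (p * Polynomial.X ^ i) = 0 := by
    intro i hi
    rw [hp, sub_mul, map_sub, hp0 i hi, ← pow_add, sub_self]
  have hpm : p.Monic := Polynomial.monic_X_pow_sub (by
    rcases eq_or_ne p0 0 with h | h
    · simp [h]
    · rw [Polynomial.degree_eq_natDegree h] at *
      norm_cast at *; try omega)
  have hpdeg : p.degree = (n + 1 : ℕ) := by
    rw [hp, Polynomial.degree_sub_eq_left_of_degree_lt (by simpa using hp0d), Polynomial.degree_X_pow]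
  -- coprimality
  have hcop : ∀ z, g.eval z = 0 → p.eval z = 0 → False := by
    intro z hgz hpz
    obtain ⟨h, hh⟩ := Polynomial.dvd_iff_isRoot.2 hgz
    obtain ⟨k, hk⟩ := Polynomial.dvd_iff_isRoot.2 hpz
    have hkm : k.Monic := (Polynomial.monic_X_sub_C z).of_mul_monic_left (hk ▸ hpm)
    have hkd : k.natDegree = n := by
      have := congrArg Polynomial.natDegree hk
      rw [(Polynomial.monic_X_sub_C z).natDegree_mul hkm, Polynomial.natDegree_X_sub_C,
        Polynomial.natDegree_eq_of_degree_eq_some hpdeg] at this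
      omega
    have hhd : h.degree < n := by
      rw [hh, Polynomial.degree_mul, Polynomial.degree_X_sub_C] at hgd
      have hhne : h ≠ 0 := by rintro rfl; simp at hh; exact hg0 hh
      rw [Polynomial.degree_eq_natDegree hhne] at *
      norm_cast at *; omega
    have e1 : Λ (p * h) = 0 :=
      lam_low n Λ p (fun i hi => hpl i (by omega)) h hhd
    have e2 : Λ (g * (k - Polynomial.X ^ n)) = 0 := by
      refine lam_low n Λ g hgl _ ?_
      have := Polynomial.degree_sub_lt_left (p := k) (q := Polynomial.X ^ n) (by
        rw [Polynomial.degree_X_pow, Polynomial.degree_eq_natDegree hkm.ne_zero, hkd]) hkm.ne_zero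
        (by rw [hkm.leadingCoeff]; simp)
      rwa [Polynomial.degree_eq_natDegree hkm.ne_zero, hkd] at this
    rw [mul_sub, map_sub, hgn, hh, mul_assoc, mul_comm h k, ← mul_assoc, ← hk, e1] at e2
    norm_num at e2
  -- Wronskian
  set W := Polynomial.derivative p * g - p * Polynomial.derivative g with hW
  have hWne : W ≠ 0 := by
    intro hz
    have hc : IsCoprime p g := by
      rw [Polynomial.isCoprime_iff_aeval_ne_zero_of_isAlgClosed ℂ ℂ]
      intro z
      by_contra hcon
      push Not at hcon
      simp only [Polynomial.coe_aeval_eq_eval] at hcon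
      exact hcop z hcon.2 hcon.1
    have h1 : p ∣ Polynomial.derivative p * g := ⟨_, sub_eq_zero.1 hz⟩
    have h2 := hc.dvd_of_dvd_mul_right h1
    have h3 := Polynomial.degree_le_of_dvd h2 (by
      intro h
      have := Polynomial.derivative_eq_zero.1 h
      rw [Polynomial.natDegree_eq_of_degree_eq_some hpdeg] at this
      omega)
    exact absurd h3 (not_le.2 (Polynomial.degree_derivative_lt hpm.ne_zero))
  set Q : ℂ → Polynomial ℂ := fun t => p + Polynomial.C t * g with hQ
  have hQdeg : ∀ t, (Polynomial.C t * g).degree < p.degree := by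
    intro t
    rw [hpdeg, ← Polynomial.smul_eq_C_mul]
    exact (Polynomial.degree_smul_le _ _).trans_lt hgd
  have hQm : ∀ t, (Q t).Monic := fun t => hpm.add_of_left (hQdeg t)
  have hQd : ∀ t, (Q t).natDegree = n + 1 := fun t =>
    Polynomial.natDegree_eq_of_degree_eq_some
      ((Polynomial.degree_add_eq_left_of_degree_lt (hQdeg t)).trans hpdeg)
  set bad : Set ℂ := (fun z => - p.eval z / g.eval z) '' (W.roots.toFinset : Set ℂ) with hbad
  have hbadfin : bad.Finite := (Finset.finite_toSet _).image _
  have hgood : (badᶜ).Infinite := hbadfin.infinite_compl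
  have hsep : ∀ t ∈ badᶜ, (Q t).roots.Nodup := by
    intro t ht
    apply Polynomial.nodup_roots
    rw [Polynomial.separable_def, Polynomial.isCoprime_iff_aeval_ne_zero_of_isAlgClosed ℂ ℂ]
    intro z
    by_contra hcon
    push Not at hcon
    simp only [Polynomial.coe_aeval_eq_eval, hQ, Polynomial.derivative_add,
      Polynomial.derivative_C_mul, Polynomial.eval_add, Polynomial.eval_mul,
      Polynomial.eval_C] at hcon
    obtain ⟨h1, h2⟩ := hcon
    have hgz : g.eval z ≠ 0 := by
      intro hgz
      rw [hgz, mul_zero, add_zero] at h1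
      exact hcop z hgz h1
    apply ht
    refine ⟨z, ?_, ?_⟩
    · rw [Finset.mem_coe, Multiset.mem_toFinset, Polynomial.mem_roots hWne,
        Polynomial.IsRoot.def, hW]
      simp only [Polynomial.eval_sub, Polynomial.eval_mul]
      linear_combination g.eval z * h2 - (Polynomial.derivative g).eval z * h1
    · simp only
      rw [div_eq_iff hgz]
      linear_combination -h1
  have hcard : ∀ t ∈ badᶜ, (Q t).roots.toFinset.card = n + 1 := by
    intro t ht
    rw [Multiset.toFinset_card_of_nodup (hsep t ht), ← hQd t]
    exact (IsAlgClosed.splits (Q t)).natDegree_eq_card_roots.symm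
  have himg : ((fun t => (Q t).roots.toFinset) '' badᶜ).Infinite := by
    apply hgood.image
    intro t ht t' ht' heq
    have h1 : (Q t).roots = (Q t').roots := by
      have := congrArg Finset.val heq
      simpa [Multiset.toFinset_val, (hsep t ht).dedup, (hsep t' ht').dedup] using this
    have h2 : Q t = Q t' := by
      rw [(IsAlgClosed.splits (Q t)).eq_prod_roots_of_monic (hQm t),
        (IsAlgClosed.splits (Q t')).eq_prod_roots_of_monic (hQm t'), h1]
    have h3 : Polynomial.C t * g = Polynomial.C t' * g := add_left_cancel h2
    exact Polynomial.C_injective (mul_right_cancel₀ hg0 h3)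
  refine himg.mono ?_
  rintro _ ⟨t, ht, rfl⟩
  refine ⟨hcard t ht, Q t, hQm t, hQd t, ?_, ?_⟩
  · intro i hi
    simp only [hQ]
    rw [add_mul, map_add, hpl i (by omega), mul_assoc, ← Polynomial.smul_eq_C_mul, map_smul,
      hgl i hi]
    simp
  · intro b hb
    have := (Polynomial.mem_roots (hQm t).ne_zero).1 (Multiset.mem_toFinset.1 hb)
    exact this

lemma linear_pow_expand (d : ℕ) (u v : ℂ) :
    (C u * X 0 + C v * X 1 : MvPolynomial (Fin 2) ℂ) ^ d =
      ∑ i ∈ Finset.range (d + 1),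
        C ((d.choose i : ℂ) * (u ^ (d - i) * v ^ i)) * X 0 ^ (d - i) * X 1 ^ i := by
  rw [add_comm, add_pow]
  refine Finset.sum_congr rfl fun i _ => ?_
  simp only [mul_pow, C_mul, C_pow, map_natCast]
  ring

lemma homog_one (L : MvPolynomial (Fin 2) ℂ) (hL : L.IsHomogeneous 1) :
    ∃ u v : ℂ, L = C u * X 0 + C v * X 1 := by
  refine ⟨L.coeff (Finsupp.single 0 1), L.coeff (Finsupp.single 1 1), ?_⟩
  have hR : (C (L.coeff (Finsupp.single 0 1)) * X 0 + C (L.coeff (Finsupp.single 1 1)) * X 1 :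
      MvPolynomial (Fin 2) ℂ).IsHomogeneous 1 := by
    refine IsHomogeneous.add ?_ ?_
    · simpa using (isHomogeneous_C (Fin 2) (L.coeff (Finsupp.single 0 1))).mul (isHomogeneous_X ℂ 0)
    · simpa using (isHomogeneous_C (Fin 2) (L.coeff (Finsupp.single 1 1))).mul (isHomogeneous_X ℂ 1)
  ext m
  by_cases hm : m.degree = 1
  · have : m = Finsupp.single 0 1 ∨ m = Finsupp.single 1 1 := by
      rw [Finsupp.degree_eq_sum, Fin.sum_univ_two] at hm
      have h : (m 0 = 1 ∧ m 1 = 0) ∨ (m 0 = 0 ∧ m 1 = 1) := by omega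
      rcases h with h | h
      · left; ext i; fin_cases i <;> simp [h.1, h.2]
      · right; ext i; fin_cases i <;> simp [h.1, h.2]
    have h10 : (Finsupp.single (1 : Fin 2) 1 : Fin 2 →₀ ℕ) ≠ Finsupp.single 0 1 := by
      intro h
      have := DFunLike.congr_fun h 0
      simp at this
    rcases this with rfl | rfl
    · simp [coeff_C_mul, coeff_X, h10]
    · simp [coeff_C_mul, coeff_X, h10.symm]
  · rw [hL.coeff_eq_zero hm, hR.coeff_eq_zero hm]

/-- Dehomogenization recovers the coefficients. -/
lemma dehom_inj (N d : ℕ) (c c' : ℕ → ℂ)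
    (h : (∑ i ∈ Finset.range N, C (c i) * X 0 ^ (d - i) * X 1 ^ i : MvPolynomial (Fin 2) ℂ) =
      ∑ i ∈ Finset.range N, C (c' i) * X 0 ^ (d - i) * X 1 ^ i) (i : ℕ) (hi : i < N) :
    c i = c' i := by
  have := congrArg (fun p => (aeval ![(1 : Polynomial ℂ), Polynomial.X] p).coeff i) h
  simpa [Polynomial.finsetSum_coeff, aeval_C, hi, ← Polynomial.C_eq_algebraMap, 
    Polynomial.coeff_C_mul, Polynomial.coeff_X_pow] using this

lemma power_sum_expand {ι : Type*} (s : Finset ι) (d : ℕ) (μ u v : ι → ℂ) :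
    ∑ k ∈ s, C (μ k) * (C (u k) * X 0 + C (v k) * X 1 : MvPolynomial (Fin 2) ℂ) ^ d =
      ∑ i ∈ Finset.range (d + 1),
        C ((d.choose i : ℂ) * ∑ k ∈ s, μ k * (u k ^ (d - i) * v k ^ i)) *
          X 0 ^ (d - i) * X 1 ^ i := by
  simp only [linear_pow_expand, Finset.mul_sum]
  rw [Finset.sum_comm]
  refine Finset.sum_congr rfl fun i _ => ?_
  rw [map_sum, Finset.sum_mul, Finset.sum_mul]
  refine Finset.sum_congr rfl fun k _ => ?_
  simp only [C_mul]
  ring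

/-- Lower bound. -/
lemma lower_bound (n s : ℕ) (A : ℕ → ℂ)
    (hdet : (Matrix.of fun i j : Fin (n+1) => A ((i : ℕ) + j)).det ≠ 0)
    (μ u v : Fin s → ℂ)
    (h : ∀ i ≤ 2 * n, A i = ∑ k, μ k * (u k ^ (2 * n - i) * v k ^ i)) : n + 1 ≤ s := by
  have hfac : (Matrix.of fun i j : Fin (n+1) => A ((i : ℕ) + j)) =
      (Matrix.of fun (i : Fin (n+1)) (k : Fin s) => μ k * (u k ^ (n - i) * v k ^ (i : ℕ))) *
      (Matrix.of fun (k : Fin s) (j : Fin (n+1)) => (u k ^ (n - j) * v k ^ (j : ℕ))) := by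
    ext i j
    rw [Matrix.mul_apply]
    simp only [Matrix.of_apply]
    rw [h _ (by omega)]
    refine Finset.sum_congr rfl fun k _ => ?_
    rw [show 2 * n - ((i : ℕ) + j) = (n - i) + (n - j) by omega, pow_add, pow_add]
    ring
  have h1 := Matrix.rank_of_isUnit _ ((Matrix.isUnit_iff_isUnit_det _).2 (isUnit_iff_ne_zero.2 hdet))
  rw [hfac] at h1
  have h2 := Matrix.rank_mul_le_left (Matrix.of fun (i : Fin (n+1)) (k : Fin s) => μ k * (u k ^ (n - i) * v k ^ (i : ℕ)))
      (Matrix.of fun (k : Fin s) (j : Fin (n+1)) => (u k ^ (n - j) * v k ^ (j : ℕ)))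
  have h3 := Matrix.rank_le_width (Matrix.of fun (i : Fin (n+1)) (k : Fin s) => μ k * (u k ^ (n - i) * v k ^ (i : ℕ)))
  rw [h1, Fintype.card_fin] at h2
  omega

/-- The generic Hankel determinant. -/
noncomputable def hankelDet (n : ℕ) : MvPolynomial (Fin (2 * (n + 1) - 1)) ℂ :=
  (Matrix.of fun i j : Fin (n+1) =>
    (X ⟨(i : ℕ) + j, by omega⟩ : MvPolynomial (Fin (2 * (n + 1) - 1)) ℂ)).det

lemma eval_hankelDet (n : ℕ) (a : Fin (2 * (n + 1) - 1) → ℂ) :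
    eval a (hankelDet n) =
      (Matrix.of fun i j : Fin (n+1) => a ⟨(i : ℕ) + j, by omega⟩).det := by
  rw [hankelDet, RingHom.map_det]
  congr 1
  ext i j
  simp

lemma hankelDet_ne_zero (n : ℕ) : hankelDet n ≠ 0 := by
  intro h
  have h1 := eval_hankelDet n (fun i => if (i : ℕ) = n then 1 else 0)
  rw [h, map_zero] at h1
  have h2 : (Matrix.of fun i j : Fin (n+1) => if (i : ℕ) + j = n then (1 : ℂ) else 0) *
      (Matrix.of fun i j : Fin (n+1) => if (i : ℕ) + j = n then (1 : ℂ) else 0) = 1 := by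
    ext i j
    rw [Matrix.mul_apply, Finset.sum_eq_single (Fin.rev i)]
    · have : ((i : ℕ) + (Fin.rev i : ℕ) = n) := by rw [Fin.val_rev]; omega
      simp only [Matrix.of_apply, this, if_true, one_mul, Matrix.one_apply]
      congr 1
      rw [Fin.val_rev, Fin.ext_iff, eq_iff_iff]
      omega
    · intro k _ hk
      have : ¬ ((i : ℕ) + k = n) := by
        intro h; apply hk; rw [Fin.ext_iff, Fin.val_rev]; omega
      simp [this]
    · simp
  have h3 := congrArg Matrix.det h2
  rw [Matrix.det_mul, Matrix.det_one] at h3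
  simp only at h1
  rw [← h1] at h3
  simp at h3



/-- (Gundelfinger's Theorem, even-degree case.) Let `r ≥ 2` and `d = 2r−2`. There is a nonzero
polynomial `F` in `d+1` variables such that whenever `F(a_0,…,a_d) ≠ 0`, the binary form
`f = Σ_{i=0}^{d} C(d,i) a_i x^{d−i} y^i` admits a decomposition
`f = Σ_{k=1}^{r} λ_k (x+β_k y)^d` with all `λ_k ≠ 0` and pairwise distinct `β_k`, its Waring
rank is `r` (i.e. `r` is the least length of a decomposition into powers of linear forms with
nonzero coefficients), and there are infinitely many distinct sets `{β_1,…,β_r} ⊂ ℂ`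
occurring in decompositions of this form. -/
theorem gundelfinger_even (r : ℕ) (hr : 2 ≤ r) :
    ∃ F : MvPolynomial (Fin (2 * r - 1)) ℂ, F ≠ 0 ∧
      ∀ a : Fin (2 * r - 1) → ℂ, eval a F ≠ 0 →
        ∀ f : MvPolynomial (Fin 2) ℂ,
          f = (∑ i : Fin (2 * r - 1),
              C (((2 * r - 2).choose i : ℂ) * a i) * X 0 ^ (2 * r - 2 - (i : ℕ)) *
                X 1 ^ (i : ℕ)) →
          (∃ lam β : Fin r → ℂ, (∀ k, lam k ≠ 0) ∧ Function.Injective β ∧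
            f = ∑ k, C (lam k) * (linForm (β k)) ^ (2 * r - 2)) ∧
          IsLeast {s : ℕ | ∃ (μ : Fin s → ℂ) (L : Fin s → MvPolynomial (Fin 2) ℂ),
              (∀ ℓ, μ ℓ ≠ 0) ∧ (∀ ℓ, (L ℓ).IsHomogeneous 1) ∧
              f = ∑ ℓ, C (μ ℓ) * (L ℓ) ^ (2 * r - 2)} r ∧
          {B : Finset ℂ | ∃ lam β : Fin r → ℂ, (∀ k, lam k ≠ 0) ∧ Function.Injective β ∧
              f = (∑ k, C (lam k) * (linForm (β k)) ^ (2 * r - 2)) ∧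
              B = Finset.univ.image β}.Infinite := by
  obtain ⟨n, rfl⟩ : ∃ n, r = n + 1 := ⟨r - 1, by omega⟩
  refine ⟨hankelDet n, hankelDet_ne_zero n, ?_⟩
  intro a ha f hf
  rw [eval_hankelDet] at ha
  set A : ℕ → ℂ := fun i => if h : i < 2 * (n + 1) - 1 then a ⟨i, h⟩ else 0 with hA
  have hAa : ∀ (i : ℕ) (h : i < 2 * (n + 1) - 1), A i = a ⟨i, h⟩ := fun i h => by
    simp only [hA, dif_pos h]
  have hdetA : (Matrix.of fun i j : Fin (n+1) => A ((i : ℕ) + j)).det ≠ 0 := by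
    convert ha using 4
    funext j
    exact hAa _ _
  set Λ : Polynomial ℂ →ₗ[ℂ] ℂ := Polynomial.lsum (fun i => LinearMap.toSpanSingleton ℂ ℂ (A i))
    with hΛ
  have hΛX : ∀ i, Λ (Polynomial.X ^ i) = A i := by
    intro i
    rw [hΛ, Polynomial.lsum_apply, Polynomial.X_pow_eq_monomial, Polynomial.sum_monomial_index] <;> simp
  have hdet : (Matrix.of fun i j : Fin (n+1) => Λ (Polynomial.X ^ ((i : ℕ) + j))).det ≠ 0 := by
    simpa only [hΛX] using hdetA
  have hd : 2 * (n + 1) - 2 = 2 * n := by omega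
  have hf' : f = ∑ i ∈ Finset.range (2 * n + 1), C (((2 * n).choose i : ℂ) * A i) *
      X 0 ^ (2 * n - i) * X 1 ^ i := by
    rw [hf, show 2 * n + 1 = 2 * (n + 1) - 1 by omega, Finset.sum_range]
    refine Finset.sum_congr rfl fun i _ => ?_
    rw [hAa i i.2, hd]
  rw [hd]
  have hinf : {B : Finset ℂ | ∃ lam β : Fin (n + 1) → ℂ, (∀ k, lam k ≠ 0) ∧
      Function.Injective β ∧ f = (∑ k, C (lam k) * (linForm (β k)) ^ (2 * n)) ∧
              B = Finset.univ.image β}.Infinite := by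
    refine (pencil n Λ hdet).mono ?_
    rintro B ⟨hB, q, hq, hqd, h0, hr0⟩
    obtain ⟨lam, hlam, hsum⟩ := quad_rule n Λ hdet q hq hqd h0 B hB hr0
    let e := B.equivFinOfCardEq hB
    have himg : B = Finset.univ.image (fun k => (e.symm k : ℂ)) := by
      ext b
      simp only [Finset.mem_image, Finset.mem_univ, true_and]
      constructor
      · intro hb; exact ⟨e ⟨b, hb⟩, by simp⟩
      · rintro ⟨k, rfl⟩; exact (e.symm k).2
    have hinj : Function.Injective (fun k => (e.symm k : ℂ)) :=
      Subtype.val_injective.comp e.symm.injective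
    refine ⟨fun k => lam (e.symm k), fun k => e.symm k, fun k => hlam _ (e.symm k).2, hinj, ?_,
      himg⟩
    have hexp := power_sum_expand Finset.univ (2 * n) (fun k : Fin (n+1) => lam (e.symm k))
      (fun _ => 1) (fun k => (e.symm k : ℂ))
    simp only [linForm]
    simp only [C_1, one_mul, one_pow] at hexp
    rw [hexp, hf']
    refine Finset.sum_congr rfl fun i hi => ?_
    rw [← hΛX, hsum i (Finset.mem_range.1 hi)]
    congr 4
    conv_lhs => rw [himg]
    rw [Finset.sum_image (fun _ _ _ _ h => hinj h)]
  have hex : ∃ lam β : Fin (n + 1) → ℂ, (∀ k, lam k ≠ 0) ∧ Function.Injective β ∧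
            f = ∑ k, C (lam k) * (linForm (β k)) ^ (2 * n) := by
    obtain ⟨B, lam, β, h1, h2, h3, -⟩ := hinf.nonempty
    exact ⟨lam, β, h1, h2, h3⟩
  refine ⟨hex, ⟨?_, ?_⟩, hinf⟩
  · obtain ⟨lam, β, h1, h2, h3⟩ := hex
    refine ⟨lam, fun k => linForm (β k), h1, fun k => ?_, h3⟩
    refine IsHomogeneous.add (isHomogeneous_X ℂ 0) ?_
    simpa using (isHomogeneous_C (Fin 2) (β k)).mul (isHomogeneous_X ℂ 1)
  · rintro s ⟨μ, L, -, hL, hfs⟩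
    choose u v huv using fun k => homog_one (L k) (hL k)
    simp only [huv] at hfs
    rw [power_sum_expand, hf'] at hfs
    refine lower_bound n s A hdetA μ u v fun i hi => ?_
    have := dehom_inj _ _ _ _ hfs i (by omega)
    exact mul_left_cancel₀ (by exact_mod_cast (Nat.choose_pos hi).ne') this
end
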